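/- arXiv:2603.16290 — 3 statements merged into one kernel-verified Lean document; each statement's English description precedes it below -/
import Mathlib

section
/- Let M ∈ ℕ, T > 0, ε > 0, a₁, a₂ > 0, and let f₁, f₂ : ℝ^M → ℝ^M be continuously differentiable with derivative maps f₁′, f₂′ taking values in the M×M real matrices. Suppose u, v₁, v₂ : ℝ² × (0, T) → ℝ^M are three times continuously differentiable and solve the 2-D Jin-Xin relaxation system. Then at every point of ℝ² × (0, T) the exact second-order (Chapman–Enskog) identity holds: ∂ₜ u + ∂_{x₁}(f₁ ∘ u) + ∂_{x₂}(f₂ ∘ u) = ε Σ_{i=1}^{2} ∂_{xᵢ}( aᵢ² ∂_{xᵢ} u − f_i′(u)(∂_{x₁} v₁ + ∂_{x₂} v₂) ) − ε² Σ_{i=1}^{2} ∂_{xᵢ} ∂ₜ ( ∂ₜ vᵢ + aᵢ² ∂_{xᵢ} u ). -/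
/-- The one-direction version of the identity: with `w = ∂ₜ v + a² ∂ₑ u`, one has
`f ∘ u = v + ε w` and `a² ∂ₑ u - f'(u) V = w + ε ∂ₜ w` on `S`, differentiated along `e`. -/
theorem jin_xin_one_direction {X E : Type*} [NormedAddCommGroup X] [NormedSpace ℝ X]
    [NormedAddCommGroup E] [NormedSpace ℝ E]
    (ε a : ℝ) (hε : 0 < ε) (f : E → E) (hf : ContDiff ℝ 1 f)
    (u v V : X → E) (S : Set X) (hS : IsOpen S)
    (hu : ContDiffOn ℝ 3 u S) (hv : ContDiffOn ℝ 3 v S) (e et : X)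
    (heq0 : ∀ p ∈ S, fderiv ℝ u p et = - V p)
    (heq : ∀ p ∈ S, fderiv ℝ v p et + a ^ 2 • fderiv ℝ u p e = -(1 / ε) • (v p - f (u p)))
    (p : X) (hp : p ∈ S) :
    fderiv ℝ (f ∘ u) p e = fderiv ℝ v p e
        + ε • fderiv ℝ (fun r => fderiv ℝ v r et + a ^ 2 • fderiv ℝ u r e) p e ∧
    fderiv ℝ (fun q => a ^ 2 • fderiv ℝ u q e - fderiv ℝ f (u q) (V q)) p e
      = fderiv ℝ (fun r => fderiv ℝ v r et + a ^ 2 • fderiv ℝ u r e) p e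
        + ε • fderiv ℝ (fun q =>
            fderiv ℝ (fun r => fderiv ℝ v r et + a ^ 2 • fderiv ℝ u r e) q et) p e := by
  set w : X → E := fun r => fderiv ℝ v r et + a ^ 2 • fderiv ℝ u r e with hw
  have hu2 : ContDiffOn ℝ 2 (fderiv ℝ u) S := hu.fderiv_of_isOpen hS (by norm_num)
  have hv2 : ContDiffOn ℝ 2 (fderiv ℝ v) S := hv.fderiv_of_isOpen hS (by norm_num)
  have hwC : ContDiffOn ℝ 2 w S :=
    (hv2.clm_apply contDiffOn_const).add
      (contDiffOn_const.smul (hu2.clm_apply contDiffOn_const))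
  have hw1 : ContDiffOn ℝ 1 (fderiv ℝ w) S := hwC.fderiv_of_isOpen hS (by norm_num)
  have hdw : ∀ q ∈ S, DifferentiableAt ℝ w q := fun q hq =>
    (hwC.differentiableOn (by norm_num)).differentiableAt (hS.mem_nhds hq)
  have hdu : ∀ q ∈ S, DifferentiableAt ℝ u q := fun q hq =>
    (hu.differentiableOn (by norm_num)).differentiableAt (hS.mem_nhds hq)
  have hdv : ∀ q ∈ S, DifferentiableAt ℝ v q := fun q hq =>
    (hv.differentiableOn (by norm_num)).differentiableAt (hS.mem_nhds hq)
  have hdtw : ∀ q ∈ S, DifferentiableAt ℝ (fun q => fderiv ℝ w q et) q := fun q hq =>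
    ((hw1.differentiableOn (by norm_num)).differentiableAt (hS.mem_nhds hq)).clm_apply
      (differentiableAt_const _)
  have hfu : ∀ q ∈ S, (f ∘ u) q = v q + ε • w q := by
    intro q hq
    have h := heq q hq
    simp only [hw, h, smul_smul, Function.comp]
    have : ε * -(1 / ε) = -1 := by field_simp
    rw [this]; module
  have hfd : ∀ q ∈ S, ∀ d, fderiv ℝ (f ∘ u) q d = fderiv ℝ v q d + ε • fderiv ℝ w q d := by
    intro q hq d
    have h1 : (f ∘ u) =ᶠ[nhds q] (fun q => v q + ε • w q) := by
      filter_upwards [hS.mem_nhds hq] with r hr using hfu r hr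
    rw [h1.fderiv_eq, fderiv_fun_add (hdv q hq) ((hdw q hq).fun_const_smul ε),
      fderiv_fun_const_smul (hdw q hq)]
    simp
  refine ⟨hfd p hp e, ?_⟩
  have h2 : (fun q => a ^ 2 • fderiv ℝ u q e - fderiv ℝ f (u q) (V q))
      =ᶠ[nhds p] (fun q => w q + ε • fderiv ℝ w q et) := by
    filter_upwards [hS.mem_nhds hp] with q hq
    have h3 := hfd q hq et
    rw [fderiv_comp q (hf.differentiable (by norm_num) _) (hdu q hq)] at h3
    simp only [ContinuousLinearMap.comp_apply, heq0 q hq, map_neg] at h3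
    rw [sub_eq_add_neg, h3]
    simp only [hw]; abel
  rw [h2.fderiv_eq, fderiv_fun_add (hdw p hp) ((hdtw p hp).fun_const_smul ε),
    fderiv_fun_const_smul (hdtw p hp)]
  simp

/-- 2-D Jin-Xin relaxation, exact second-order (Chapman–Enskog)
identity. If `u, v₁, v₂ : ℝ² × (0,T) → ℝ^M` are three times continuously
differentiable and solve the 2-D Jin-Xin relaxation system, then at every point
of `ℝ² × (0,T)`,
`∂ₜ u + ∂_{x₁}(f₁ ∘ u) + ∂_{x₂}(f₂ ∘ u)
  = ε Σᵢ ∂_{xᵢ}( aᵢ² ∂_{xᵢ} u − fᵢ′(u)(∂_{x₁} v₁ + ∂_{x₂} v₂) )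
    − ε² Σᵢ ∂_{xᵢ} ∂ₜ ( ∂ₜ vᵢ + aᵢ² ∂_{xᵢ} u )`,
where `fᵢ′(u)` is the (Fréchet) Jacobian of `fᵢ` at `u`. A space-time point is
`(x₁, x₂, t) : ℝ × ℝ × ℝ`; the directions `ex₁, ex₂, et` are `(1,0,0)`,
`(0,1,0)`, `(0,0,1)`. -/
theorem jin_xin_2d_chapman_enskog_identity
    (M : ℕ) (T ε a₁ a₂ : ℝ) (hT : 0 < T) (hε : 0 < ε) (ha₁ : 0 < a₁) (ha₂ : 0 < a₂)
    (f₁ f₂ : EuclideanSpace ℝ (Fin M) → EuclideanSpace ℝ (Fin M))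
    (hf₁ : ContDiff ℝ 1 f₁) (hf₂ : ContDiff ℝ 1 f₂)
    (u v₁ v₂ : ℝ × ℝ × ℝ → EuclideanSpace ℝ (Fin M))
    (S : Set (ℝ × ℝ × ℝ)) (hS : S = {p : ℝ × ℝ × ℝ | p.2.2 ∈ Set.Ioo 0 T})
    (hu : ContDiffOn ℝ 3 u S) (hv₁ : ContDiffOn ℝ 3 v₁ S) (hv₂ : ContDiffOn ℝ 3 v₂ S)
    (ex₁ ex₂ et : ℝ × ℝ × ℝ)
    (hex₁ : ex₁ = (1, 0, 0)) (hex₂ : ex₂ = (0, 1, 0)) (het : et = (0, 0, 1))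
    (heq₀ : ∀ p ∈ S, fderiv ℝ u p et + fderiv ℝ v₁ p ex₁ + fderiv ℝ v₂ p ex₂ = 0)
    (heq₁ : ∀ p ∈ S, fderiv ℝ v₁ p et + a₁ ^ 2 • fderiv ℝ u p ex₁
        = -(1 / ε) • (v₁ p - f₁ (u p)))
    (heq₂ : ∀ p ∈ S, fderiv ℝ v₂ p et + a₂ ^ 2 • fderiv ℝ u p ex₂
        = -(1 / ε) • (v₂ p - f₂ (u p))) :
    ∀ p ∈ S,
      fderiv ℝ u p et + fderiv ℝ (f₁ ∘ u) p ex₁ + fderiv ℝ (f₂ ∘ u) p ex₂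
        = ε • (fderiv ℝ (fun q => a₁ ^ 2 • fderiv ℝ u q ex₁
                 - fderiv ℝ f₁ (u q) (fderiv ℝ v₁ q ex₁ + fderiv ℝ v₂ q ex₂)) p ex₁
             + fderiv ℝ (fun q => a₂ ^ 2 • fderiv ℝ u q ex₂
                 - fderiv ℝ f₂ (u q) (fderiv ℝ v₁ q ex₁ + fderiv ℝ v₂ q ex₂)) p ex₂)
        - ε ^ 2 •
            (fderiv ℝ (fun q =>
                fderiv ℝ (fun r => fderiv ℝ v₁ r et + a₁ ^ 2 • fderiv ℝ u r ex₁) q et)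
              p ex₁
           + fderiv ℝ (fun q =>
                fderiv ℝ (fun r => fderiv ℝ v₂ r et + a₂ ^ 2 • fderiv ℝ u r ex₂) q et)
              p ex₂) := by
  intro p hp
  have hSo : IsOpen S := by
    rw [hS]
    exact isOpen_Ioo.preimage (continuous_snd.comp continuous_snd)
  have h0 : ∀ q ∈ S, fderiv ℝ u q et = -(fderiv ℝ v₁ q ex₁ + fderiv ℝ v₂ q ex₂) := by
    intro q hq
    have h := heq₀ q hq
    rw [add_assoc] at h
    exact eq_neg_of_add_eq_zero_left h
  obtain ⟨h1, h2⟩ := jin_xin_one_direction ε a₁ hε f₁ hf₁ u v₁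
    (fun q => fderiv ℝ v₁ q ex₁ + fderiv ℝ v₂ q ex₂) S hSo hu hv₁ ex₁ et h0 heq₁ p hp
  obtain ⟨h3, h4⟩ := jin_xin_one_direction ε a₂ hε f₂ hf₂ u v₂
    (fun q => fderiv ℝ v₁ q ex₁ + fderiv ℝ v₂ q ex₂) S hSo hu hv₂ ex₂ et h0 heq₂ p hp
  rw [h1, h2, h3, h4, h0 p hp]
  module
end

section
/- Let M ∈ ℕ, let a₁, a₂ > 0 and b₁, b₂ ≥ 0 satisfy the elliptic condition b₁²/a₁² + b₂²/a₂² ≤ 1, and let A₁₁, A₁₂, A₂₁, A₂₂ be M×M real matrices whose ℓ²-operator norms satisfy ‖A_{ij}‖ ≤ bᵢ bⱼ for all i, j ∈ {1, 2}. Then for all vectors p, q ∈ ℝ^M, ⟨(a₁² I − A₁₁) p, p⟩ − ⟨A₁₂ q, p⟩ + ⟨(a₂² I − A₂₂) q, q⟩ − ⟨A₂₁ p, q⟩ ≥ 0, where ⟨·,·⟩ is the Euclidean inner product and I the M×M identity matrix. -/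
open scoped RealInnerProductSpace

/-- Under the elliptic condition `b₁²/a₁² + b₂²/a₂² ≤ 1`, if the
`M×M` matrices `A_{ij}` (viewed as operators on Euclidean `ℝ^M`) satisfy the
operator-norm bounds `‖A_{ij}‖ ≤ bᵢ bⱼ`, then for all `p, q ∈ ℝ^M`,
`⟨(a₁² I − A₁₁) p, p⟩ − ⟨A₁₂ q, p⟩ + ⟨(a₂² I − A₂₂) q, q⟩ − ⟨A₂₁ p, q⟩ ≥ 0`. -/
theorem elliptic_pointwise_dissipativity (M : ℕ) (a₁ a₂ b₁ b₂ : ℝ)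
    (ha₁ : 0 < a₁) (ha₂ : 0 < a₂) (hb₁ : 0 ≤ b₁) (hb₂ : 0 ≤ b₂)
    (hell : b₁ ^ 2 / a₁ ^ 2 + b₂ ^ 2 / a₂ ^ 2 ≤ 1)
    (A₁₁ A₁₂ A₂₁ A₂₂ : EuclideanSpace ℝ (Fin M) →L[ℝ] EuclideanSpace ℝ (Fin M))
    (hA₁₁ : ‖A₁₁‖ ≤ b₁ * b₁) (hA₁₂ : ‖A₁₂‖ ≤ b₁ * b₂)
    (hA₂₁ : ‖A₂₁‖ ≤ b₂ * b₁) (hA₂₂ : ‖A₂₂‖ ≤ b₂ * b₂)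
    (p q : EuclideanSpace ℝ (Fin M)) :
    0 ≤ ⟪a₁ ^ 2 • p - A₁₁ p, p⟫ - ⟪A₁₂ q, p⟫
        + ⟪a₂ ^ 2 • q - A₂₂ q, q⟫ - ⟪A₂₁ p, q⟫ := by
  have key : ∀ (A : EuclideanSpace ℝ (Fin M) →L[ℝ] EuclideanSpace ℝ (Fin M)) (c : ℝ)
      (_ : ‖A‖ ≤ c) (x y : EuclideanSpace ℝ (Fin M)), ⟪A x, y⟫ ≤ c * ‖x‖ * ‖y‖ := by
    intro A c hc x y
    calc ⟪A x, y⟫ ≤ ‖A x‖ * ‖y‖ := real_inner_le_norm _ _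
      _ ≤ (c * ‖x‖) * ‖y‖ :=
        mul_le_mul_of_nonneg_right (A.le_of_opNorm_le hc x) (norm_nonneg y)
  have h11 := key A₁₁ _ hA₁₁ p p
  have h12 := key A₁₂ _ hA₁₂ q p
  have h21 := key A₂₁ _ hA₂₁ p q
  have h22 := key A₂₂ _ hA₂₂ q q
  have cs : (b₁ * ‖p‖ + b₂ * ‖q‖) ^ 2 ≤ (a₁ * ‖p‖) ^ 2 + (a₂ * ‖q‖) ^ 2 := by
    obtain ⟨c, rfl⟩ : ∃ c, b₁ = c * a₁ := ⟨b₁ / a₁, by field_simp⟩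
    obtain ⟨d, rfl⟩ : ∃ d, b₂ = d * a₂ := ⟨b₂ / a₂, by field_simp⟩
    have hcd : c ^ 2 + d ^ 2 ≤ 1 := by
      have e1 : (c * a₁) ^ 2 / a₁ ^ 2 = c ^ 2 := by field_simp
      have e2 : (d * a₂) ^ 2 / a₂ ^ 2 = d ^ 2 := by field_simp
      rwa [e1, e2] at hell
    have hm := mul_le_mul_of_nonneg_right hcd
      (add_nonneg (sq_nonneg (a₁ * ‖p‖)) (sq_nonneg (a₂ * ‖q‖)))
    linarith [sq_nonneg (c * (a₂ * ‖q‖) - d * (a₁ * ‖p‖))]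
  rw [inner_sub_left, inner_sub_left, real_inner_smul_left, real_inner_smul_left,
    real_inner_self_eq_norm_sq, real_inner_self_eq_norm_sq]
  linarith
end

section
/- Let M ∈ ℕ, let a₁, a₂ > 0 and b₁, b₂ ≥ 0 satisfy the elliptic condition b₁²/a₁² + b₂²/a₂² ≤ 1, and let A₁₁, A₁₂, A₂₁, A₂₂ : ℝ² → M×M real matrices be continuous matrix fields with ‖A_{ij}(x)‖ ≤ bᵢ bⱼ (ℓ²-operator norm) for all x ∈ ℝ² and i, j ∈ {1, 2}. Then for every continuously differentiable, compactly supported u : ℝ² → ℝ^M, the bilinear form value B(u, u) := −∫_{ℝ²} [ ⟨(a₁² I − A₁₁(x)) ∂_{x₁} u − A₁₂(x) ∂_{x₂} u, ∂_{x₁} u⟩ + ⟨(a₂² I − A₂₂(x)) ∂_{x₂} u − A₂₁(x) ∂_{x₁} u, ∂_{x₂} u⟩ ] dx satisfies B(u, u) ≤ 0. -/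
open scoped RealInnerProductSpace

/-- Under the elliptic condition `b₁²/a₁² + b₂²/a₂² ≤ 1`, if the
continuous matrix fields `A_{ij} : ℝ² → ℝ^{M×M}` (viewed as operators on
Euclidean `ℝ^M`) satisfy the pointwise operator-norm bounds
`‖A_{ij}(x)‖ ≤ bᵢ bⱼ`, then for every continuously differentiable, compactly
supported `u : ℝ² → ℝ^M`, the bilinear form value
`B(u, u) = −∫ [⟨(a₁² I − A₁₁) ∂₁u − A₁₂ ∂₂u, ∂₁u⟩ + ⟨(a₂² I − A₂₂) ∂₂u − A₂₁ ∂₁u, ∂₂u⟩] dx`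
satisfies `B(u, u) ≤ 0`. Points of `ℝ²` are pairs `(x₁, x₂) : ℝ × ℝ` and
`∂ᵢ u x = fderiv ℝ u x eᵢ` with `e₁ = (1,0)`, `e₂ = (0,1)`. -/
theorem elliptic_bilinear_form_nonpos (M : ℕ) (a₁ a₂ b₁ b₂ : ℝ)
    (ha₁ : 0 < a₁) (ha₂ : 0 < a₂) (hb₁ : 0 ≤ b₁) (hb₂ : 0 ≤ b₂)
    (hell : b₁ ^ 2 / a₁ ^ 2 + b₂ ^ 2 / a₂ ^ 2 ≤ 1)
    (A₁₁ A₁₂ A₂₁ A₂₂ : ℝ × ℝ → (EuclideanSpace ℝ (Fin M) →L[ℝ] EuclideanSpace ℝ (Fin M)))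
    (hA₁₁c : Continuous A₁₁) (hA₁₂c : Continuous A₁₂)
    (hA₂₁c : Continuous A₂₁) (hA₂₂c : Continuous A₂₂)
    (hA₁₁ : ∀ x, ‖A₁₁ x‖ ≤ b₁ * b₁) (hA₁₂ : ∀ x, ‖A₁₂ x‖ ≤ b₁ * b₂)
    (hA₂₁ : ∀ x, ‖A₂₁ x‖ ≤ b₂ * b₁) (hA₂₂ : ∀ x, ‖A₂₂ x‖ ≤ b₂ * b₂)
    (u : ℝ × ℝ → EuclideanSpace ℝ (Fin M))
    (hu : ContDiff ℝ 1 u) (hsupp : HasCompactSupport u) :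
    -(∫ x : ℝ × ℝ,
        (⟪a₁ ^ 2 • fderiv ℝ u x (1, 0) - A₁₁ x (fderiv ℝ u x (1, 0))
            - A₁₂ x (fderiv ℝ u x (0, 1)), fderiv ℝ u x (1, 0)⟫
       + ⟪a₂ ^ 2 • fderiv ℝ u x (0, 1) - A₂₂ x (fderiv ℝ u x (0, 1))
            - A₂₁ x (fderiv ℝ u x (1, 0)), fderiv ℝ u x (0, 1)⟫)) ≤ 0 := by
  rw [neg_nonpos]
  refine MeasureTheory.integral_nonneg fun x => ?_
  generalize fderiv ℝ u x (1, 0) = v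
  generalize fderiv ℝ u x (0, 1) = w
  have key : ∀ (A : EuclideanSpace ℝ (Fin M) →L[ℝ] EuclideanSpace ℝ (Fin M)) (c : ℝ)
      (y z : EuclideanSpace ℝ (Fin M)), ‖A‖ ≤ c → ⟪A y, z⟫ ≤ c * ‖y‖ * ‖z‖ := by
    intro A c y z h
    refine (real_inner_le_norm _ _).trans ?_
    gcongr
    exact A.le_of_opNorm_le h y
  have h1 := key _ _ v v (hA₁₁ x)
  have h2 := key _ _ w v (hA₁₂ x)
  have h3 := key _ _ v w (hA₂₁ x)
  have h4 := key _ _ w w (hA₂₂ x)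
  simp only [Pi.zero_apply, inner_sub_left, real_inner_smul_left, real_inner_self_eq_norm_sq]
  generalize ‖v‖ = p at *
  generalize ‖w‖ = q at *
  obtain ⟨s, rfl⟩ : ∃ s, b₁ = s * a₁ := ⟨b₁ / a₁, by field_simp⟩
  obtain ⟨t, rfl⟩ : ∃ t, b₂ = t * a₂ := ⟨b₂ / a₂, by field_simp⟩
  have hst : s ^ 2 + t ^ 2 ≤ 1 := by
    have e1 : (s * a₁) ^ 2 / a₁ ^ 2 = s ^ 2 := by field_simp
    have e2 : (t * a₂) ^ 2 / a₂ ^ 2 = t ^ 2 := by field_simp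
    rwa [e1, e2] at hell
  have h5 : 0 ≤ (1 - s ^ 2 - t ^ 2) * ((a₁ * p) ^ 2 + (a₂ * q) ^ 2) :=
    mul_nonneg (by linarith) (by positivity)
  have h6 := sq_nonneg (t * (a₁ * p) - s * (a₂ * q))
  nlinarith only [h1, h2, h3, h4, h5, h6]
end
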